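/- Let X be a countable Markov shift, φ: X → ℝ a measurable function and μ_φ a Gibbs state for φ. Then the sequence {ξ_n} of distributions of the empirical measures under μ_φ is exponentially tight: for every L > 0 there exists a compact set K_L ⊂ M such that limsup_{n→∞} (1/n) log ξ_n(M \ K_L) ≤ -L. If moreover X is finitely primitive, then the sequences η_n, η_{a,n}, ζ_{y,n} and ζ_{a,y,n} (a ∈ S, y ∈ X) are also exponentially tight. -/

import Mathlib

open MeasureTheory Filter Topology Set
open scoped ENNReal NNReal

namespace CMS

/-! ### Generic dynamical notions -/

variable {X : Type*}

/-- Birkhoff sum `S_n φ`. -/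
noncomputable def birkhoff (T : X → X) (φ : X → ℝ) (n : ℕ) (x : X) : ℝ :=
  ∑ i ∈ Finset.range n, φ (T^[i] x)

/-- A measure is invariant under `T`. -/
def Invariant [MeasurableSpace X] (T : X → X) (μ : Measure X) : Prop :=
  Measure.map T μ = μ

/-- `∫ φ dμ > -∞`, i.e. the negative part of `φ` is integrable. -/
def IntegralGtBot [MeasurableSpace X] (φ : X → ℝ) (μ : Measure X) : Prop :=
  (∫⁻ x, ENNReal.ofReal (-φ x) ∂μ) ≠ ⊤

/-- The integral of `φ`, with values in `EReal` (defined whenever one of the parts is finite). -/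
noncomputable def eintegral [MeasurableSpace X] (φ : X → ℝ) (μ : Measure X) : EReal :=
  ((∫⁻ x, ENNReal.ofReal (φ x) ∂μ : ℝ≥0∞) : EReal) -
    ((∫⁻ x, ENNReal.ofReal (-φ x) ∂μ : ℝ≥0∞) : EReal)

/-- Entropy of the countable partition induced by a map `g` with countable range. -/
noncomputable def partitionEntropy [MeasurableSpace X] {α : Type*} (μ : Measure X) (g : X → α) :
    ℝ≥0∞ :=
  ∑' a : α, ENNReal.ofReal (-((μ (g ⁻¹' {a})).toReal * Real.log ((μ (g ⁻¹' {a})).toReal)))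

/-- Kolmogorov–Sinaĭ entropy of `T` with respect to `μ`: the supremum over finite measurable
partitions (coded by maps `X → ℕ` with finite range) of the asymptotic entropy of iterated
joins of the partition. -/
noncomputable def entropy [MeasurableSpace X] (T : X → X) (μ : Measure X) : ℝ≥0∞ :=
  ⨆ (p : X → ℕ) (_ : Measurable p ∧ (Set.range p).Finite),
    atTop.liminf fun n : ℕ =>
      ENNReal.ofReal ((n : ℝ)⁻¹) * partitionEntropy μ (fun x => fun i : Fin n => p (T^[i] x))

/-- The empirical measure `δ_x^n = (1/n) ∑_{i<n} δ_{T^i x}` (with junk convention `n = 0 ↦ n = 1`,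
irrelevant since only `n ≥ 1` is ever used). -/
noncomputable def empirical [MeasurableSpace X] (T : X → X) (x : X) (n : ℕ) :
    ProbabilityMeasure X :=
  ⟨((max n 1 : ℕ) : ℝ≥0∞)⁻¹ • ∑ i ∈ Finset.range (max n 1), Measure.dirac (T^[i] x), by
    refine ⟨?_⟩
    have h1 : (∑ i ∈ Finset.range (max n 1), Measure.dirac (T^[i] x)) Set.univ
        = ((max n 1 : ℕ) : ℝ≥0∞) := by
      rw [Measure.finset_sum_apply]
      simp
    rw [Measure.smul_apply, h1, smul_eq_mul, ENNReal.inv_mul_cancel] <;> simp⟩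

noncomputable instance [MeasurableSpace X] [TopologicalSpace X] [OpensMeasurableSpace X] :
    MeasurableSpace (ProbabilityMeasure X) := borel _

/-- Sets of periodic points. -/
def perSet (T : X → X) (n : ℕ) : Set X := {x | T^[n] x = x}

/-- Sets of iterated preimages of a point. -/
def preimSet (T : X → X) (n : ℕ) (y : X) : Set X := {x | T^[n] x = y}

/-- The partition function `Z_n(φ, C)` over a subset `C`. -/
noncomputable def Zfn [MeasurableSpace X] (T : X → X) (φ : X → ℝ) (n : ℕ) (C : Set X) : ℝ≥0∞ :=
  ∑' x : C, ENNReal.ofReal (Real.exp (birkhoff T φ n x))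

/-- The distribution of the empirical measures under `μ`. -/
noncomputable def empDistr [MeasurableSpace X] [TopologicalSpace X] [OpensMeasurableSpace X]
    (T : X → X) (μ : Measure X) (n : ℕ) : Measure (ProbabilityMeasure X) :=
  Measure.map (fun x => empirical T x n) μ

/-- The distribution `Z_n(φ,C)⁻¹ ∑_{x ∈ C} e^{S_nφ(x)} δ_{δ_x^n}` on the space of probability
measures, for a countable set `C` (of weighted periodic points or iterated preimages). -/
noncomputable def weightedDistr [MeasurableSpace X] [TopologicalSpace X] [OpensMeasurableSpace X]
    (T : X → X) (φ : X → ℝ) (n : ℕ) (C : Set X) : Measure (ProbabilityMeasure X) :=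
  (Zfn T φ n C)⁻¹ •
    Measure.sum (fun x : C =>
      ENNReal.ofReal (Real.exp (birkhoff T φ n x)) • Measure.dirac (empirical T (x : X) n))

/-! ### Large deviations notions -/

variable {Y : Type*}

/-- The large deviation principle for a sequence of (sub)probability measures with rate
function `J`. -/
def HasLDP [TopologicalSpace Y] [MeasurableSpace Y] (μ : ℕ → Measure Y) (J : Y → EReal) : Prop :=
  (∀ G : Set Y, IsOpen G →
      -(⨅ y ∈ G, J y) ≤
        atTop.liminf fun n : ℕ => (((n : ℝ)⁻¹ : ℝ) : EReal) * ENNReal.log (μ n G)) ∧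
  (∀ K : Set Y, IsClosed K →
      atTop.limsup (fun n : ℕ => (((n : ℝ)⁻¹ : ℝ) : EReal) * ENNReal.log (μ n K)) ≤
        -(⨅ y ∈ K, J y))

/-- Exponential tightness of a sequence of measures. -/
def ExpTight [TopologicalSpace Y] [MeasurableSpace Y] (μ : ℕ → Measure Y) : Prop :=
  ∀ L : ℝ, 0 < L → ∃ K : Set Y, IsCompact K ∧
    atTop.limsup (fun n : ℕ => (((n : ℝ)⁻¹ : ℝ) : EReal) * ENNReal.log (μ n Kᶜ)) ≤ ((-L : ℝ) : EReal)

/-- A good rate function: lower semicontinuous with compact sublevel sets. -/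
def GoodRate [TopologicalSpace Y] (J : Y → EReal) : Prop :=
  LowerSemicontinuous J ∧ ∀ α : ℝ, 0 ≤ α → IsCompact {y | J y ≤ (α : EReal)}

/-- The rate function `I(μ) = - inf_{G ∋ μ} sup_G F`. -/
noncomputable def rateOf [TopologicalSpace Y] (F : Y → EReal) (μ : Y) : EReal :=
  -(⨅ (G : Set Y) (_ : IsOpen G ∧ μ ∈ G), ⨆ ν ∈ G, F ν)

/-- The convex combination `t μ + (1-t) ν` of two probability measures. -/
noncomputable def mix [MeasurableSpace X] (t : ℝ) (h0 : 0 ≤ t) (h1 : t ≤ 1)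
    (μ ν : ProbabilityMeasure X) : ProbabilityMeasure X :=
  ⟨ENNReal.ofReal t • (μ : Measure X) + ENNReal.ofReal (1 - t) • (ν : Measure X), by
    refine ⟨?_⟩
    simp only [Measure.add_apply, Measure.smul_apply, smul_eq_mul, measure_univ, mul_one]
    rw [← ENNReal.ofReal_add h0 (by linarith)]
    norm_num⟩

/-- Convexity of a rate function on probability measures. -/
def ConvexRate [MeasurableSpace X] (J : ProbabilityMeasure X → EReal) : Prop :=
  ∀ μ ν : ProbabilityMeasure X, ∀ t : ℝ, ∀ (h0 : 0 ≤ t) (h1 : t ≤ 1),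
    J (mix t h0 h1 μ ν) ≤ ((t : ℝ) : EReal) * J μ + ((1 - t : ℝ) : EReal) * J ν

-- The free energy functional `F`.
open Classical in
noncomputable def freeEnergy [MeasurableSpace X] (T : X → X) (φ : X → ℝ) (P : ℝ)
    (ν : ProbabilityMeasure X) : EReal :=
  if Invariant T (ν : Measure X) ∧ IntegralGtBot φ (ν : Measure X)
  then ((entropy T (ν : Measure X) : ℝ≥0∞) : EReal) + eintegral φ (ν : Measure X) - ((P : ℝ) : EReal)
  else ⊥

/-! ### Countable Markov shifts -/

variable {S : Type*}

/-- The topological Markov shift with alphabet `S` and transition relation `A`. -/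
def Space (A : S → S → Prop) : Type _ := {x : ℕ → S // ∀ i, A (x i) (x (i + 1))}

variable (A : S → S → Prop)

instance [TopologicalSpace S] : TopologicalSpace (Space A) :=
  inferInstanceAs (TopologicalSpace {x : ℕ → S // ∀ i, A (x i) (x (i + 1))})

noncomputable instance [TopologicalSpace S] : MeasurableSpace (Space A) := borel _

instance [TopologicalSpace S] : BorelSpace (Space A) := ⟨rfl⟩

/-- The left shift. -/
def shift : Space A → Space A := fun x => ⟨fun i => x.1 (i + 1), fun i => x.2 (i + 1)⟩

/-- Admissible words. -/
def Admissible (w : List S) : Prop := w ≠ [] ∧ w.Chain' A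

/-- The cylinder set of a word. -/
def cylinder (w : List S) : Set (Space A) := {x | ∀ i : Fin w.length, x.1 i = w.get i}

variable {A}

/-- The initial word of length `n` of a point. -/
def word (x : Space A) (n : ℕ) : List S := List.ofFn (fun i : Fin n => x.1 i)

variable (A)

/-- `μ` is a Gibbs state for the potential `φ` with constants `c₀` and `P`. -/
def IsGibbsWith [TopologicalSpace S] (φ : Space A → ℝ) (μ : Measure (Space A)) (c₀ P : ℝ) :
    Prop :=
  ∀ n : ℕ, 1 ≤ n → ∀ x : Space A,
    c₀⁻¹ * Real.exp (-(P * n) + birkhoff (shift A) φ n x)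
        ≤ (μ (cylinder A (word x n))).toReal ∧
      (μ (cylinder A (word x n))).toReal
        ≤ c₀ * Real.exp (-(P * n) + birkhoff (shift A) φ n x)

/-- `μ` is a Gibbs state for `φ`. -/
def IsGibbs [TopologicalSpace S] (φ : Space A → ℝ) (μ : Measure (Space A)) : Prop :=
  ∃ c₀ P : ℝ, 1 ≤ c₀ ∧ IsGibbsWith A φ μ c₀ P

/-- The transition matrix has no row or column identically zero. -/
def NoZeroRowCol : Prop := (∀ a : S, ∃ b, A a b) ∧ ∀ b : S, ∃ a, A a b

/-- Finite irreducibility. -/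
def FinitelyIrreducible : Prop :=
  ∃ Λ : Finset (List S), ∀ v w : List S, Admissible A v → Admissible A w →
    ∃ l ∈ Λ, Admissible A (v ++ l ++ w)

/-- Finite primitiveness. -/
def FinitelyPrimitive : Prop :=
  ∃ Λ : Finset (List S), (∃ N : ℕ, ∀ l ∈ Λ, l.length = N) ∧
    ∀ v w : List S, Admissible A v → Admissible A w →
      ∃ l ∈ Λ, Admissible A (v ++ l ++ w)

/-- Topological transitivity. -/
def TopTransitive : Prop :=
  ∀ a b : S, ∃ n : ℕ, 1 ≤ n ∧
    (cylinder A [a] ∩ (shift A)^[n] ⁻¹' (cylinder A [b])).Nonempty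

/-- Varadhan's functional `Q(ψ) = sup_μ (∫ψ dμ - I(μ))`. -/
noncomputable def varQ {X : Type*} [MeasurableSpace X] (I : ProbabilityMeasure X → EReal)
    (ψ : X → ℝ) : EReal :=
  ⨆ μ : ProbabilityMeasure X, (((∫ x, ψ x ∂(μ : Measure X)) : ℝ) : EReal) - I μ

/-- `φ` is uniformly continuous for the standard metric of the shift space. -/
def UnifCont (φ : Space A → ℝ) : Prop :=
  ∀ ε : ℝ, 0 < ε → ∃ N : ℕ, ∀ x y : Space A, (∀ i < N, x.1 i = y.1 i) → |φ x - φ y| ≤ ε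

/-- `φ` is bounded. -/
def Bdd (φ : Space A → ℝ) : Prop := ∃ C : ℝ, ∀ x : Space A, |φ x| ≤ C

end CMS

namespace CMS

section Generic

/-- A bound `μ n Kᶜ ≤ e^{-Ln}` for large `n` with `K` compact, for every `L`, gives exponential
tightness. -/
lemma ExpTight.of_eventually_le {Y : Type*} [TopologicalSpace Y] [MeasurableSpace Y]
    {μ : ℕ → Measure Y}
    (h : ∀ L : ℝ, 0 < L → ∃ K : Set Y, IsCompact K ∧
      ∀ᶠ n : ℕ in atTop, μ n Kᶜ ≤ ENNReal.ofReal (Real.exp (-(L * n)))) : ExpTight μ := by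
  intro L hL
  obtain ⟨K, hK, hn⟩ := h L hL
  refine ⟨K, hK, ?_⟩
  refine Filter.limsup_le_of_le (by isBoundedDefault) ?_
  filter_upwards [hn, eventually_ge_atTop 1] with n hn h1
  have hn0 : (0 : ℝ) < n := by exact_mod_cast h1
  have h2 : ENNReal.log (μ n Kᶜ) ≤ ((-(L * n) : ℝ) : EReal) := by
    have := ENNReal.log_le_log hn
    rwa [ENNReal.log_ofReal_of_pos (Real.exp_pos _), Real.log_exp] at this
  calc (((n : ℝ)⁻¹ : ℝ) : EReal) * ENNReal.log (μ n Kᶜ)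
      ≤ (((n : ℝ)⁻¹ : ℝ) : EReal) * ((-(L * n) : ℝ) : EReal) :=
        mul_le_mul_of_nonneg_left h2 (by exact_mod_cast (inv_pos.2 hn0).le)
    _ = ((-L : ℝ) : EReal) := by
        rw [← EReal.coe_mul]
        congr 1
        field_simp

lemma exists_le_ofReal_exp {q : ℝ≥0∞} (hq : q ≠ ⊤) : ∃ T : ℝ, q ≤ ENNReal.ofReal (Real.exp T) := by
  refine ⟨q.toReal, ?_⟩
  rw [ENNReal.le_ofReal_iff_toReal_le hq (Real.exp_pos _).le]
  linarith [Real.add_one_le_exp q.toReal]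

lemma ofReal_exp_pow (a : ℝ) (n : ℕ) :
    ENNReal.ofReal (Real.exp a) ^ n = ENNReal.ofReal (Real.exp (n * a)) := by
  rw [← ENNReal.ofReal_pow (Real.exp_pos _).le, ← Real.exp_nat_mul]

/-- A summable family admits a function with finite sublevel sets that is still exponentially
integrable. -/
lemma exists_finite_sublevel_tsum_exp_ne_top {S : Type*} [Countable S] (p : S → ℝ≥0∞)
    (hp : ∑' a, p a ≠ ⊤) :
    ∃ g : S → ℝ, (∀ a, 0 ≤ g a) ∧ (∀ M : ℝ, {a | g a ≤ M}.Finite) ∧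
      ∑' a, p a * ENNReal.ofReal (Real.exp (g a)) ≠ ⊤ := by
  classical
  obtain ⟨e, he⟩ := exists_injective_nat S
  obtain ⟨δ, hδ, hδs⟩ := ENNReal.exists_pos_sum_of_countable' one_ne_zero ℕ
  have hF : ∀ m : ℕ, ∃ F : Finset S, (m : ℝ≥0∞) * ∑' a : {a // a ∉ F}, p a ≤ δ m := by
    intro m
    have h0 : Tendsto (fun F : Finset S => (m : ℝ≥0∞) * ∑' a : {a // a ∉ F}, p a) atTop
        (𝓝 ((m : ℝ≥0∞) * 0)) :=
      ENNReal.Tendsto.const_mul (ENNReal.tendsto_tsum_compl_atTop_zero hp)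
        (Or.inr (ENNReal.natCast_ne_top m))
    rw [mul_zero] at h0
    exact (h0.eventually_le_const (hδ m)).exists
  choose F hF using hF
  let f : S → ℕ := fun a => 1 + ∑ m ∈ Finset.range (e a + 1), if a ∈ F m then 0 else m
  have hf1 : ∀ a, (1 : ℝ) ≤ f a := fun a => by
    simp only [f]; push_cast
    exact le_add_of_nonneg_right (Finset.sum_nonneg fun _ _ => by positivity)
  refine ⟨fun a => Real.log (f a), fun a => Real.log_nonneg (hf1 a), fun M => ?_, ?_⟩
  · obtain ⟨m, hm⟩ := exists_nat_gt (Real.exp M)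
    refine ((F m).finite_toSet.union ((Set.finite_lt_nat m).preimage he.injOn)).subset ?_
    intro a ha
    by_contra hcon
    simp only [Set.mem_union, Finset.mem_coe, Set.mem_preimage, Set.mem_ofPred_eq, not_or,
      not_lt] at hcon ha
    have h1 : m ≤ f a := by
      have := Finset.single_le_sum (f := fun m => if a ∈ F m then 0 else m)
        (fun _ _ => Nat.zero_le _)
        (show m ∈ Finset.range (e a + 1) from Finset.mem_range.2 (Nat.lt_succ_of_le hcon.2))
      simp only [hcon.1, if_false] at this
      simp only [f]; omega
    have h2 : (f a : ℝ) ≤ Real.exp M := (Real.log_le_iff_le_exp (by linarith [hf1 a])).1 ha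
    have h3 : (m : ℝ) ≤ f a := by exact_mod_cast h1
    linarith
  · have h1 : ∀ a, p a * ENNReal.ofReal (Real.exp (Real.log (f a)))
        ≤ p a + ∑' m : ℕ, (m : ℝ≥0∞) * (if a ∈ F m then 0 else p a) := by
      intro a
      rw [Real.exp_log (by linarith [hf1 a]), ENNReal.ofReal_natCast]
      simp only [f]
      push_cast
      rw [mul_add, mul_one, Finset.mul_sum]
      gcongr
      refine le_trans (Finset.sum_le_sum fun m _ => ?_) (ENNReal.sum_le_tsum _)
      split_ifs
      · simp
      · rw [mul_comm]
    refine ne_top_of_le_ne_top ?_ (ENNReal.tsum_le_tsum h1)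
    rw [ENNReal.tsum_add, ENNReal.tsum_comm]
    refine ENNReal.add_ne_top.2 ⟨hp, ne_top_of_le_ne_top (hδs.trans ENNReal.one_lt_top).ne
      (ENNReal.tsum_le_tsum fun m => le_trans (le_of_eq ?_) (hF m))⟩
    rw [ENNReal.tsum_mul_left]
    congr 1
    refine Eq.trans ?_ (tsum_subtype {a | a ∉ F m} p).symm
    refine tsum_congr fun a => ?_
    by_cases h : a ∈ F m <;> simp [Set.indicator, h]

lemma tsum_fin_pi_prod {S : Type*} (F : S → ℝ≥0∞) (n : ℕ) :
    ∑' v : Fin n → S, ∏ k, F (v k) = (∑' a, F a) ^ n := by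
  induction n with
  | zero => simp
  | succ n ih =>
    rw [← (Fin.consEquiv fun _ : Fin (n + 1) => S).tsum_eq, ENNReal.tsum_prod', pow_succ', ← ih,
      ← ENNReal.tsum_mul_right]
    refine tsum_congr fun a => ?_
    rw [← ENNReal.tsum_mul_left]
    refine tsum_congr fun v => ?_
    simp [Fin.consEquiv, Fin.prod_univ_succ]

end Generic

section Space

variable {S : Type*} {A : S → S → Prop}

lemma shift_iterate_apply (x : Space A) (k i : ℕ) : ((shift A)^[k] x).1 i = x.1 (i + k) := by
  induction k generalizing i with
  | zero => rfl
  | succ k ih =>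
    rw [Function.iterate_succ_apply']
    change ((shift A)^[k] x).1 (i + 1) = _
    rw [ih]
    exact congrArg x.1 (by omega)

lemma mem_cylinder_word {x y : Space A} {n : ℕ} :
    y ∈ cylinder A (word x n) ↔ ∀ k < n, y.1 k = x.1 k := by
  simp only [cylinder, word, Set.mem_ofPred_eq, List.get_eq_getElem, List.getElem_ofFn]
  constructor
  · intro h k hk
    exact h ⟨k, by simpa using hk⟩
  · intro h k
    exact h k (by simpa using k.2)

lemma mem_cylinder_singleton {x : Space A} {a : S} : x ∈ cylinder A [a] ↔ x.1 0 = a := by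
  constructor
  · intro h
    exact h ⟨0, by simp⟩
  · rintro h ⟨k, hk⟩
    have : k = 0 := by simpa using hk
    subst this
    exact h

lemma word_one (x : Space A) : word x 1 = [x.1 0] := by simp [word]

variable [TopologicalSpace S]

lemma continuous_coord (i : ℕ) : Continuous fun x : Space A => x.1 i :=
  (continuous_apply i).comp continuous_subtype_val

variable [DiscreteTopology S]

instance : T2Space (Space A) :=
  inferInstanceAs (T2Space {x : ℕ → S // ∀ i, A (x i) (x (i + 1))})

lemma measurable_coord (g : S → ℝ) (i : ℕ) : Measurable fun x : Space A => g (x.1 i) :=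
  ((continuous_of_discreteTopology (f := g)).comp (continuous_coord i)).measurable

lemma isClosedEmbedding_val : IsClosedEmbedding (Subtype.val : Space A → ℕ → S) := by
  refine IsClosed.isClosedEmbedding_subtypeVal ?_
  change IsClosed {x : ℕ → S | ∀ i, A (x i) (x (i + 1))}
  rw [Set.ofPred_forall]
  refine isClosed_iInter fun i => ?_
  have hc : Continuous fun x : ℕ → S => (x i, x (i + 1)) :=
    (continuous_apply i).prodMk (continuous_apply (i + 1))
  exact (isClosed_discrete {q : S × S | A q.1 q.2}).preimage hc

instance [Countable S] : TopologicalSpace.MetrizableSpace (Space A) :=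
  haveI := DiscreteTopology.secondCountableTopology_of_countable (α := S)
  haveI : SecondCountableTopology (Space A) :=
    isClosedEmbedding_val.isInducing.secondCountableTopology
  haveI : T3Space (Space A) :=
    inferInstanceAs (T3Space {x : ℕ → S // ∀ i, A (x i) (x (i + 1))})
  TopologicalSpace.metrizableSpace_of_t3_secondCountable _

/-- Product sets of sublevel sets of a function with finite sublevel sets are compact. -/
lemma isCompact_forall_coord_le {g : S → ℝ} (hg : ∀ M : ℝ, {a | g a ≤ M}.Finite) (M : ℕ → ℝ) :
    IsCompact {x : Space A | ∀ i, g (x.1 i) ≤ M i} := by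
  have h := isClosedEmbedding_val (A := A).isCompact_preimage
    (isCompact_univ_pi fun i => (hg (M i)).isCompact)
  have heq : {x : Space A | ∀ i, g (x.1 i) ≤ M i} =
      Subtype.val ⁻¹' Set.pi Set.univ fun i => {a | g a ≤ M i} :=
    Set.ext fun x => ⟨fun hx i _ => hx i, fun hx i => hx i trivial⟩
  rw [heq]
  exact h

/-- Uniform moment bounds in all coordinates give relatively compact sets of measures. -/
lemma isCompact_closure_moment_le {g : S → ℝ} (hg : ∀ M : ℝ, {a | g a ≤ M}.Finite)
    (R : ℕ → ℝ) :
    IsCompact (closure {ν : ProbabilityMeasure (Space A) | ∀ i,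
      ∫⁻ x, ENNReal.ofReal (g (x.1 i)) ∂(ν : Measure (Space A)) ≤ ENNReal.ofReal (R i)}) := by
  refine isCompact_closure_of_isTightMeasureSet ?_
  rw [isTightMeasureSet_iff_exists_isCompact_measure_compl_le]
  intro ε hε
  obtain ⟨δ, hδ, hδs⟩ := ENNReal.exists_pos_sum_of_countable hε.ne' ℕ
  let M : ℕ → ℝ := fun i => (max (R i) 0 + 1) / δ i
  have hM : ∀ i, 0 < M i := fun i => div_pos (by positivity) (by exact_mod_cast hδ i)
  refine ⟨_, isCompact_forall_coord_le hg M, ?_⟩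
  rintro _ ⟨ν, hν, rfl⟩
  have hsub : {x : Space A | ∀ i, g (x.1 i) ≤ M i}ᶜ ⊆
      ⋃ i, {x : Space A | ENNReal.ofReal (M i) ≤ ENNReal.ofReal (g (x.1 i))} := by
    intro x hx
    simp only [Set.mem_compl_iff, Set.mem_ofPred_eq, not_forall, not_le] at hx
    obtain ⟨i, hi⟩ := hx
    exact Set.mem_iUnion.2 ⟨i, ENNReal.ofReal_le_ofReal hi.le⟩
  calc (ν : Measure (Space A)) _ ≤ _ := measure_mono hsub
    _ ≤ ∑' i, (ν : Measure (Space A))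
          {x : Space A | ENNReal.ofReal (M i) ≤ ENNReal.ofReal (g (x.1 i))} := measure_iUnion_le _
    _ ≤ ∑' i, (δ i : ℝ≥0∞) := ENNReal.tsum_le_tsum fun i => ?_
    _ ≤ ε := hδs.le
  refine (meas_ge_le_lintegral_div (measurable_coord g i).ennreal_ofReal.aemeasurable
    (by simpa using hM i) ENNReal.ofReal_ne_top).trans ?_
  refine ENNReal.div_le_of_le_mul ((hν i).trans ?_)
  rw [← ENNReal.ofReal_coe_nnreal, ← ENNReal.ofReal_mul (by positivity)]
  refine ENNReal.ofReal_le_ofReal ?_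
  have : (δ i : ℝ) * M i = max (R i) 0 + 1 := mul_div_cancel₀ _ (by exact_mod_cast (hδ i).ne')
  rw [this]
  linarith [le_max_left (R i) 0]

lemma lintegral_empirical {g : S → ℝ} (hg : ∀ a, 0 ≤ g a) (x : Space A) {n : ℕ} (hn : 1 ≤ n)
    (i : ℕ) :
    ∫⁻ z, ENNReal.ofReal (g (z.1 i)) ∂(empirical (shift A) x n : Measure (Space A))
      = ENNReal.ofReal ((n : ℝ)⁻¹ * ∑ k ∈ Finset.range n, g (x.1 (i + k))) := by
  change ∫⁻ z, ENNReal.ofReal (g (z.1 i)) ∂(((max n 1 : ℕ) : ℝ≥0∞)⁻¹ •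
    ∑ k ∈ Finset.range (max n 1), Measure.dirac ((shift A)^[k] x)) = _
  have hn0 : (0 : ℝ) < n := by exact_mod_cast hn
  rw [max_eq_left hn, lintegral_smul_measure, lintegral_finsetSum_measure, smul_eq_mul,
    ENNReal.ofReal_mul (by positivity), ENNReal.ofReal_sum_of_nonneg (fun k _ => hg _),
    ENNReal.ofReal_inv_of_pos hn0, ENNReal.ofReal_natCast]
  congr 1
  refine Finset.sum_congr rfl fun k _ => ?_
  rw [lintegral_dirac' _ (measurable_coord g i).ennreal_ofReal, shift_iterate_apply]

lemma exists_lt_sum_of_empirical_notMem {g : S → ℝ} (hg : ∀ a, 0 ≤ g a) {R : ℕ → ℝ}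
    (x : Space A) {n : ℕ} (hn : 1 ≤ n)
    (hx : empirical (shift A) x n ∉ closure {ν : ProbabilityMeasure (Space A) | ∀ i,
      ∫⁻ z, ENNReal.ofReal (g (z.1 i)) ∂(ν : Measure (Space A)) ≤ ENNReal.ofReal (R i)}) :
    ∃ i, n * R i < ∑ k ∈ Finset.range n, g (x.1 (i + k)) := by
  by_contra! hcon
  refine hx (subset_closure fun i => ?_)
  rw [lintegral_empirical hg x hn i]
  refine ENNReal.ofReal_le_ofReal ?_
  have hn0 : (0 : ℝ) < n := by exact_mod_cast hn
  rw [inv_mul_le_iff₀ hn0]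
  exact hcon i

end Space

section Gibbs

variable {S : Type*} {A : S → S → Prop} [TopologicalSpace S] {φ : Space A → ℝ}
  {μ : Measure (Space A)} {c₀ P : ℝ}

lemma birkhoff_add {X : Type*} (T : X → X) (φ : X → ℝ) (i n : ℕ) (x : X) :
    birkhoff T φ (i + n) x = birkhoff T φ i x + birkhoff T φ n (T^[i] x) := by
  simp only [birkhoff, Finset.sum_range_add, ← Function.iterate_add_apply, add_comm]

lemma IsGibbsWith.measure_le [IsProbabilityMeasure μ] (h : IsGibbsWith A φ μ c₀ P)
    {n : ℕ} (hn : 1 ≤ n) (x : Space A) :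
    μ (cylinder A (word x n))
      ≤ ENNReal.ofReal c₀ * ENNReal.ofReal (Real.exp (-(P * n) + birkhoff (shift A) φ n x)) := by
  rw [← ENNReal.ofReal_mul' (Real.exp_pos _).le]
  refine (ENNReal.le_ofReal_iff_toReal_le (measure_ne_top _ _) ?_).2 (h n hn x).2
  exact ENNReal.toReal_nonneg.trans (h n hn x).2

lemma IsGibbsWith.ofReal_exp_le [IsProbabilityMeasure μ] (h : IsGibbsWith A φ μ c₀ P)
    (hc₀ : 1 ≤ c₀) (n : ℕ) (x : Space A) :
    ENNReal.ofReal (Real.exp (-(P * n) + birkhoff (shift A) φ n x))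
      ≤ ENNReal.ofReal c₀ * μ (cylinder A (word x n)) := by
  rcases Nat.eq_zero_or_pos n with rfl | hn
  · have h1 : cylinder A (word x 0) = Set.univ :=
      Set.eq_univ_of_forall fun y => mem_cylinder_word.2 (by simp)
    simpa [h1, birkhoff] using hc₀
  · have hc : 0 < c₀ := by linarith
    rw [← ENNReal.ofReal_toReal (measure_ne_top μ (cylinder A (word x n))),
      ← ENNReal.ofReal_mul hc.le]
    exact ENNReal.ofReal_le_ofReal ((inv_mul_le_iff₀ hc).1 (h n hn x).1)

lemma IsGibbsWith.ofReal_exp_le_prod [IsProbabilityMeasure μ] (h : IsGibbsWith A φ μ c₀ P)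
    (hc₀ : 1 ≤ c₀) (n : ℕ) (x : Space A) :
    ENNReal.ofReal (Real.exp (-(P * n) + birkhoff (shift A) φ n x))
      ≤ ∏ k ∈ Finset.range n, (ENNReal.ofReal c₀ * μ (cylinder A [x.1 k])) := by
  have h1 : -(P * n) + birkhoff (shift A) φ n x
      = ∑ k ∈ Finset.range n, (-P + φ ((shift A)^[k] x)) := by
    simp [birkhoff, Finset.sum_add_distrib, mul_comm]
  rw [h1, Real.exp_sum, ENNReal.ofReal_prod_of_nonneg fun _ _ => (Real.exp_pos _).le]
  refine Finset.prod_le_prod' fun k _ => ?_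
  have h2 := h.ofReal_exp_le hc₀ 1 ((shift A)^[k] x)
  rw [word_one, shift_iterate_apply] at h2
  simpa [birkhoff] using h2

lemma one_le_chernoff {S : Type*} (g : S → ℝ) {n : ℕ} {r : ℝ} {v : Fin n → S}
    (h : n * r ≤ ∑ k, g (v k)) :
    1 ≤ ENNReal.ofReal (Real.exp (-(n * r))) * ∏ k, ENNReal.ofReal (Real.exp (g (v k))) := by
  rw [← ENNReal.ofReal_prod_of_nonneg fun _ _ => (Real.exp_pos _).le, ← Real.exp_sum,
    ← ENNReal.ofReal_mul (Real.exp_pos _).le, ← Real.exp_add, ENNReal.one_le_ofReal,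
    Real.one_le_exp_iff]
  linarith

/-- Chernoff bound for weighted sums over sets of points determined by their first `n` letters. -/
lemma IsGibbsWith.tsum_exp_birkhoff_indicator_le [IsProbabilityMeasure μ]
    (h : IsGibbsWith A φ μ c₀ P) (hc₀ : 1 ≤ c₀) (g : S → ℝ) (n : ℕ) (r : ℝ)
    {C : Set (Space A)} (hC : ∀ x ∈ C, ∀ y ∈ C, (∀ k < n, x.1 k = y.1 k) → x = y) :
    ∑' x : C, ENNReal.ofReal (Real.exp (birkhoff (shift A) φ n x)) *
        {x : Space A | n * r < ∑ k ∈ Finset.range n, g (x.1 k)}.indicator 1 (x : Space A)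
      ≤ ENNReal.ofReal (Real.exp (-(n * r))) *
        (ENNReal.ofReal (Real.exp P) * ENNReal.ofReal c₀ *
          ∑' a, μ (cylinder A [a]) * ENNReal.ofReal (Real.exp (g a))) ^ n := by
  let D : S → ℝ≥0∞ := fun a => ENNReal.ofReal (Real.exp P) * ENNReal.ofReal c₀ *
    (μ (cylinder A [a]) * ENNReal.ofReal (Real.exp (g a)))
  let V : C → Fin n → S := fun x k => x.1.1 k
  have hV : Function.Injective V := fun x y hxy =>
    Subtype.ext (hC x x.2 y y.2 fun k hk => congrFun hxy ⟨k, hk⟩)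
  have hterm : ∀ x : C, ENNReal.ofReal (Real.exp (birkhoff (shift A) φ n x)) *
        {x : Space A | n * r < ∑ k ∈ Finset.range n, g (x.1 k)}.indicator 1 (x : Space A)
      ≤ ENNReal.ofReal (Real.exp (-(n * r))) * ∏ k, D (V x k) := by
    intro x
    by_cases hx : (x : Space A) ∈ {x : Space A | n * r < ∑ k ∈ Finset.range n, g (x.1 k)}
    · have h5 : n * r ≤ ∑ k, g (V x k) := by
        refine (le_of_lt hx).trans (le_of_eq ?_)
        rw [Finset.sum_range]
      have h6 : ENNReal.ofReal (Real.exp (birkhoff (shift A) φ n x))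
          = ENNReal.ofReal (Real.exp P) ^ n *
            ENNReal.ofReal (Real.exp (-(P * n) + birkhoff (shift A) φ n x)) := by
        rw [ofReal_exp_pow, ← ENNReal.ofReal_mul (Real.exp_pos _).le, ← Real.exp_add]
        congr 2
        ring
      have h7 := h.ofReal_exp_le_prod hc₀ n x
      rw [Finset.prod_range] at h7
      rw [Set.indicator_of_mem hx, Pi.one_apply, mul_one, h6]
      calc _ ≤ ENNReal.ofReal (Real.exp P) ^ n *
            ∏ k, (ENNReal.ofReal c₀ * μ (cylinder A [V x k])) := by gcongr
        _ ≤ ENNReal.ofReal (Real.exp P) ^ n *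
            (∏ k, (ENNReal.ofReal c₀ * μ (cylinder A [V x k]))) *
            (ENNReal.ofReal (Real.exp (-(n * r))) * ∏ k, ENNReal.ofReal (Real.exp (g (V x k)))) :=
            le_mul_of_one_le_right zero_le (one_le_chernoff g h5)
        _ = _ := by
            simp only [D, Finset.prod_mul_distrib, Finset.prod_const, Finset.card_univ,
              Fintype.card_fin]
            ring
    · rw [Set.indicator_of_notMem hx, mul_zero]
      exact zero_le
  calc _ ≤ _ := ENNReal.tsum_le_tsum hterm
    _ ≤ ∑' v : Fin n → S, ENNReal.ofReal (Real.exp (-(n * r))) * ∏ k, D (v k) :=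
        ENNReal.tsum_comp_le_tsum_of_injective hV
          (fun v => ENNReal.ofReal (Real.exp (-(n * r))) * ∏ k, D (v k))
    _ = _ := by
        rw [ENNReal.tsum_mul_left, tsum_fin_pi_prod]
        simp only [D, ENNReal.tsum_mul_left]

variable [DiscreteTopology S]

lemma measurableSet_forall_coord_eq {i : ℕ} (u : Fin i → S) :
    MeasurableSet {x : Space A | ∀ k : Fin i, x.1 k = u k} := by
  rw [Set.ofPred_forall]
  exact (isOpen_iInter_of_finite fun k =>
    (isOpen_discrete {u k}).preimage (continuous_coord (A := A) k)).measurableSet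

lemma tsum_measure_cylinder_le [IsProbabilityMeasure μ] (i : ℕ) :
    ∑' u : Fin i → S, μ {x : Space A | ∀ k : Fin i, x.1 k = u k} ≤ 1 := by
  rw [← measure_univ (μ := μ)]
  refine tsum_meas_le_meas_iUnion_of_disjoint μ measurableSet_forall_coord_eq ?_ |>.trans
    (measure_mono (Set.subset_univ _))
  intro u v huv
  refine Set.disjoint_left.2 fun x hx hx' => huv (funext fun k => ?_)
  exact (hx k).symm.trans (hx' k)

lemma tsum_measure_cylinder_singleton_le [IsProbabilityMeasure μ] :
    ∑' a : S, μ (cylinder A [a]) ≤ 1 := by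
  have h := tsum_measure_cylinder_le (μ := μ) 1
  rw [← (Equiv.funUnique (Fin 1) S).symm.tsum_eq] at h
  refine le_trans (le_of_eq (tsum_congr fun a => congrArg μ (Set.ext fun x => ?_))) h
  rw [mem_cylinder_singleton]
  simp [Equiv.funUnique]

/-- Chernoff bound for the ergodic averages of a function of one coordinate, started at any
time. -/
lemma IsGibbsWith.measure_lt_sum_le [Countable S] [IsProbabilityMeasure μ]
    (h : IsGibbsWith A φ μ c₀ P) (hc₀ : 1 ≤ c₀) (g : S → ℝ) {n : ℕ} (hn : 1 ≤ n) (i : ℕ) (r : ℝ) :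
    μ {x : Space A | n * r < ∑ k ∈ Finset.range n, g (x.1 (i + k))}
      ≤ ENNReal.ofReal c₀ ^ 2 * ENNReal.ofReal (Real.exp (-(n * r))) *
        (ENNReal.ofReal c₀ * ∑' a, μ (cylinder A [a]) * ENNReal.ofReal (Real.exp (g a))) ^ n := by
  set B := {x : Space A | n * r < ∑ k ∈ Finset.range n, g (x.1 (i + k))}
  let E : (Fin i → S) × (Fin n → S) → Set (Space A) := fun w =>
    {x | (∀ k : Fin i, x.1 k = w.1 k) ∧ ∀ k : Fin n, x.1 (i + k) = w.2 k} ∩ B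
  let D : S → ℝ≥0∞ := fun a =>
    ENNReal.ofReal c₀ * (μ (cylinder A [a]) * ENNReal.ofReal (Real.exp (g a)))
  have hsub : B ⊆ ⋃ w, E w := fun x hx =>
    Set.mem_iUnion.2 ⟨(fun k => x.1 k, fun k => x.1 (i + k)), ⟨fun _ => rfl, fun _ => rfl⟩, hx⟩
  have hE : ∀ w, μ (E w) ≤ (ENNReal.ofReal c₀ ^ 2 * ENNReal.ofReal (Real.exp (-(n * r)))) *
      (μ {x : Space A | ∀ k : Fin i, x.1 k = w.1 k} * ∏ k, D (w.2 k)) := by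
    rintro ⟨u, v⟩
    rcases (E (u, v)).eq_empty_or_nonempty with he | ⟨x, ⟨hxu, hxv⟩, hxB⟩
    · simp [he]
    have h1 : E (u, v) ⊆ cylinder A (word x (i + n)) := by
      rintro y ⟨⟨hyu, hyv⟩, -⟩
      refine mem_cylinder_word.2 fun k hk => ?_
      rcases lt_or_ge k i with hki | hki
      · exact (hyu ⟨k, hki⟩).trans (hxu ⟨k, hki⟩).symm
      · obtain ⟨j, rfl⟩ := Nat.exists_eq_add_of_le hki
        exact (hyv ⟨j, by omega⟩).trans (hxv ⟨j, by omega⟩).symm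
    have h2 : cylinder A (word x i) = {x : Space A | ∀ k : Fin i, x.1 k = u k} := by
      ext y
      rw [mem_cylinder_word]
      exact ⟨fun hy k => (hy k k.2).trans (hxu k), fun hy k hk =>
        (hy ⟨k, hk⟩).trans (hxu ⟨k, hk⟩).symm⟩
    have h3 : ENNReal.ofReal (Real.exp (-(P * ↑(i + n)) + birkhoff (shift A) φ (i + n) x))
        = ENNReal.ofReal (Real.exp (-(P * i) + birkhoff (shift A) φ i x)) *
          ENNReal.ofReal (Real.exp (-(P * n) + birkhoff (shift A) φ n ((shift A)^[i] x))) := by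
      rw [← ENNReal.ofReal_mul (Real.exp_pos _).le, ← Real.exp_add, birkhoff_add]
      congr 2
      push_cast
      ring
    have h4 : ∏ k ∈ Finset.range n, (ENNReal.ofReal c₀ *
        μ (cylinder A [((shift A)^[i] x).1 k]))
          = ∏ k, (ENNReal.ofReal c₀ * μ (cylinder A [v k])) := by
      rw [Finset.prod_range]
      refine Finset.prod_congr rfl fun k _ => ?_
      rw [shift_iterate_apply, add_comm, hxv]
    have h5 : n * r ≤ ∑ k, g (v k) := by
      refine (le_of_lt hxB).trans (le_of_eq ?_)
      rw [Finset.sum_range]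
      exact Finset.sum_congr rfl fun k _ => by rw [hxv]
    calc μ (E (u, v)) ≤ _ := measure_mono h1
      _ ≤ _ := h.measure_le (by omega) x
      _ ≤ ENNReal.ofReal c₀ * ((ENNReal.ofReal c₀ * μ {x : Space A | ∀ k : Fin i, x.1 k = u k}) *
            ∏ k, (ENNReal.ofReal c₀ * μ (cylinder A [v k]))) := by
          rw [h3, ← h2, ← h4]
          gcongr
          · exact h.ofReal_exp_le hc₀ i x
          · exact h.ofReal_exp_le_prod hc₀ n _
      _ ≤ ENNReal.ofReal c₀ * ((ENNReal.ofReal c₀ * μ {x : Space A | ∀ k : Fin i, x.1 k = u k}) *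
            ∏ k, (ENNReal.ofReal c₀ * μ (cylinder A [v k]))) *
            (ENNReal.ofReal (Real.exp (-(n * r))) * ∏ k, ENNReal.ofReal (Real.exp (g (v k)))) :=
          le_mul_of_one_le_right zero_le (one_le_chernoff g h5)
      _ = _ := by
          simp only [D, Finset.prod_mul_distrib]
          ring
  calc μ B ≤ _ := measure_mono hsub
    _ ≤ _ := measure_iUnion_le _
    _ ≤ _ := ENNReal.tsum_le_tsum hE
    _ = (ENNReal.ofReal c₀ ^ 2 * ENNReal.ofReal (Real.exp (-(n * r)))) *
        ((∑' u : Fin i → S, μ {x : Space A | ∀ k : Fin i, x.1 k = u k}) *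
          (ENNReal.ofReal c₀ *
            ∑' a, μ (cylinder A [a]) * ENNReal.ofReal (Real.exp (g a))) ^ n) := by
        simp only [ENNReal.tsum_mul_left, ENNReal.tsum_prod', ENNReal.tsum_mul_right]
        rw [tsum_fin_pi_prod D]
        simp only [D, ENNReal.tsum_mul_left]
    _ ≤ _ := by
        gcongr
        exact mul_le_of_le_one_left zero_le (tsum_measure_cylinder_le i)

end Gibbs

section Tightness

variable {S : Type*} {A : S → S → Prop} [TopologicalSpace S] {φ : Space A → ℝ}
  {μ : Measure (Space A)} {c₀ P : ℝ}

instance {X : Type*} [TopologicalSpace X] [MeasurableSpace X] [OpensMeasurableSpace X] :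
    BorelSpace (ProbabilityMeasure X) := ⟨rfl⟩

lemma empDistr_le {X : Type*} [TopologicalSpace X] [MeasurableSpace X] [OpensMeasurableSpace X]
    (T : X → X) (μ : Measure X) (n : ℕ) {B : Set (ProbabilityMeasure X)} (hB : MeasurableSet B) :
    empDistr T μ n B ≤ μ {x | empirical T x n ∈ B} := by
  by_cases hm : AEMeasurable (fun x => empirical T x n) μ
  · exact (Measure.map_apply_of_aemeasurable hm hB).le
  · simp [empDistr, Measure.map_of_not_aemeasurable hm]

lemma weightedDistr_apply {X : Type*} [TopologicalSpace X] [MeasurableSpace X]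
    [OpensMeasurableSpace X] (T : X → X) (φ : X → ℝ) (n : ℕ) (C : Set X)
    {B : Set (ProbabilityMeasure X)} (hB : MeasurableSet B) :
    weightedDistr T φ n C B = (Zfn T φ n C)⁻¹ * ∑' x : C,
      ENNReal.ofReal (Real.exp (birkhoff T φ n x)) *
        {x | empirical T x n ∈ B}.indicator 1 (x : X) := by
  simp only [weightedDistr, Measure.smul_apply, smul_eq_mul, Measure.sum_apply _ hB,
    Measure.dirac_apply' _ hB]
  rfl

lemma inv_Zfn_le {X : Type*} [MeasurableSpace X] (T : X → X) (φ : X → ℝ) {n : ℕ} {C : Set X}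
    {D : ℝ} {x : X} (hx : x ∈ C) (hD : -D ≤ birkhoff T φ n x) :
    (Zfn T φ n C)⁻¹ ≤ ENNReal.ofReal (Real.exp D) := by
  rw [← neg_neg D, Real.exp_neg (-D), ENNReal.ofReal_inv_of_pos (Real.exp_pos _)]
  exact ENNReal.inv_le_inv.2 ((ENNReal.ofReal_le_ofReal (Real.exp_le_exp.2 hD)).trans
    (ENNReal.le_tsum (⟨x, hx⟩ : C)))

/-- Along orbits whose first `n` letters lie in a fixed finite alphabet, Birkhoff sums of a
potential with a Gibbs state decrease at most linearly. -/
lemma IsGibbsWith.exists_neg_mul_le_birkhoff (h : IsGibbsWith A φ μ c₀ P) (hc₀ : 1 ≤ c₀)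
    (F : Finset S) :
    ∃ D : ℝ, ∀ (n : ℕ) (x : Space A), (∀ k < n, x.1 k ∈ F) →
      -(D * n) ≤ birkhoff (shift A) φ n x := by
  let β : S → ℝ := fun a => Real.log ((μ (cylinder A [a])).toReal / c₀) + P
  have hc : 0 < c₀ := by linarith
  have hβ : ∀ x : Space A, β (x.1 0) ≤ φ x := by
    intro x
    obtain ⟨h1, h2⟩ := h 1 le_rfl x
    rw [word_one] at h1 h2
    have hpos : 0 < (μ (cylinder A [x.1 0])).toReal :=
      lt_of_lt_of_le (mul_pos (inv_pos.2 hc) (Real.exp_pos _)) h1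
    have h3 : Real.log ((μ (cylinder A [x.1 0])).toReal / c₀) ≤ -P + φ x := by
      rw [Real.log_le_iff_le_exp (by positivity), div_le_iff₀' hc]
      simpa [birkhoff] using h2
    simp only [β]
    linarith
  refine ⟨∑ a ∈ F, |β a|, fun n x hx => ?_⟩
  have h1 : ∑ k ∈ Finset.range n, -(∑ a ∈ F, |β a|) ≤ birkhoff (shift A) φ n x := by
    refine Finset.sum_le_sum fun k hk => ?_
    have h2 := hβ ((shift A)^[k] x)
    rw [shift_iterate_apply, zero_add] at h2
    have h3 : |β (x.1 k)| ≤ ∑ a ∈ F, |β a| :=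
      Finset.single_le_sum (f := fun a => |β a|) (fun _ _ => abs_nonneg _)
        (hx k (Finset.mem_range.1 hk))
    linarith [neg_abs_le (β (x.1 k))]
  simpa [mul_comm] using h1

variable [DiscreteTopology S] [Countable S]

theorem IsGibbsWith.expTight_empDistr [IsProbabilityMeasure μ] (h : IsGibbsWith A φ μ c₀ P)
    (hc₀ : 1 ≤ c₀) : ExpTight (fun n => empDistr (shift A) μ n) := by
  obtain ⟨g, hg0, hgfin, hgs⟩ := exists_finite_sublevel_tsum_exp_ne_top
    (fun a => μ (cylinder A [a]))
    (ne_top_of_le_ne_top ENNReal.one_ne_top tsum_measure_cylinder_singleton_le)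
  set Q := ∑' a, μ (cylinder A [a]) * ENNReal.ofReal (Real.exp (g a))
  obtain ⟨T, hT⟩ := exists_le_ofReal_exp (q := ENNReal.ofReal c₀ ^ 2 * (ENNReal.ofReal c₀ * Q))
    (by finiteness)
  obtain ⟨δ, hδ, hδs⟩ := ENNReal.exists_pos_sum_of_countable one_ne_zero ℕ
  refine ExpTight.of_eventually_le fun L hL => ?_
  let R : ℕ → ℝ := fun i => L + T - Real.log (δ i)
  have hK := isCompact_closure_moment_le (A := A) hgfin R
  refine ⟨_, hK, ?_⟩
  filter_upwards [eventually_ge_atTop 1] with n hn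
  refine (empDistr_le _ _ _ hK.isClosed.measurableSet.compl).trans ?_
  have hsub : {x : Space A | empirical (shift A) x n ∈ (closure {ν : ProbabilityMeasure (Space A) |
      ∀ i, ∫⁻ z, ENNReal.ofReal (g (z.1 i)) ∂(ν : Measure (Space A)) ≤ ENNReal.ofReal (R i)})ᶜ} ⊆
      ⋃ i, {x : Space A | n * R i < ∑ k ∈ Finset.range n, g (x.1 (i + k))} := fun x hx =>
    Set.mem_iUnion.2 (exists_lt_sum_of_empirical_notMem hg0 x hn hx)
  have hi : ∀ i, μ {x : Space A | n * R i < ∑ k ∈ Finset.range n, g (x.1 (i + k))}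
      ≤ ENNReal.ofReal (Real.exp (-(L * n))) * δ i := by
    intro i
    have hδ1 : (δ i : ℝ) ≤ 1 := by
      exact_mod_cast (ENNReal.le_tsum i).trans hδs.le
    have hδ0 : (0 : ℝ) < δ i := by exact_mod_cast hδ i
    calc _ ≤ ENNReal.ofReal c₀ ^ 2 * ENNReal.ofReal (Real.exp (-(n * R i))) *
          (ENNReal.ofReal c₀ * Q) ^ n := h.measure_lt_sum_le hc₀ g hn i (R i)
      _ ≤ (ENNReal.ofReal c₀ ^ 2) ^ n * ENNReal.ofReal (Real.exp (-(n * R i))) *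
          (ENNReal.ofReal c₀ * Q) ^ n := by
          refine mul_le_mul_left (mul_le_mul_left (le_self_pow₀ (one_le_pow₀ ?_)
            (Nat.one_le_iff_ne_zero.1 hn)) _) _
          exact ENNReal.one_le_ofReal.2 hc₀
      _ = ENNReal.ofReal (Real.exp (-(n * R i))) *
          (ENNReal.ofReal c₀ ^ 2 * (ENNReal.ofReal c₀ * Q)) ^ n := by ring
      _ ≤ ENNReal.ofReal (Real.exp (-(n * R i))) * ENNReal.ofReal (Real.exp T) ^ n := by
          gcongr
      _ ≤ _ := by
          rw [ofReal_exp_pow, ← ENNReal.ofReal_mul (Real.exp_pos _).le, ← Real.exp_add,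
            ← ENNReal.ofReal_coe_nnreal, ← ENNReal.ofReal_mul (Real.exp_pos _).le]
          refine ENNReal.ofReal_le_ofReal ?_
          have h1 : -(n * R i) + n * T = -(L * n) + n * Real.log (δ i) := by
            simp only [R]; ring
          rw [h1, Real.exp_add, Real.exp_nat_mul, Real.exp_log hδ0]
          gcongr
          exact pow_le_of_le_one hδ0.le hδ1 (by omega)
  calc _ ≤ _ := measure_mono hsub
    _ ≤ _ := measure_iUnion_le _
    _ ≤ _ := ENNReal.tsum_le_tsum hi
    _ ≤ _ := by
        rw [ENNReal.tsum_mul_left]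
        exact mul_le_of_le_one_right zero_le hδs.le

/-- Exponential tightness of weighted empirical measures over sets `C n` of points determined by
their first `n` letters, provided shifted averages over `C n` are controlled by unshifted ones and
`C n` contains points whose Birkhoff sums decrease at most linearly. -/
theorem IsGibbsWith.expTight_weightedDistr [IsProbabilityMeasure μ] (h : IsGibbsWith A φ μ c₀ P)
    (hc₀ : 1 ≤ c₀) {C : ℕ → Set (Space A)}
    (hinj : ∀ n, 1 ≤ n → ∀ x ∈ C n, ∀ y ∈ C n, (∀ k < n, x.1 k = y.1 k) → x = y)
    (hshift : ∀ g : S → ℝ, (∀ a, 0 ≤ g a) → ∃ B : ℕ → ℝ, ∀ n, 1 ≤ n → ∀ x ∈ C n, ∀ i,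
      ∑ k ∈ Finset.range n, g (x.1 (i + k)) ≤ ∑ k ∈ Finset.range n, g (x.1 k) + n * B i)
    (hlow : ∃ D : ℝ, ∀ᶠ n : ℕ in atTop, ∃ x ∈ C n, -(D * n) ≤ birkhoff (shift A) φ n x) :
    ExpTight (fun n => weightedDistr (shift A) φ n (C n)) := by
  obtain ⟨g, hg0, hgfin, hgs⟩ := exists_finite_sublevel_tsum_exp_ne_top
    (fun a => μ (cylinder A [a]))
    (ne_top_of_le_ne_top ENNReal.one_ne_top tsum_measure_cylinder_singleton_le)
  set Q := ∑' a, μ (cylinder A [a]) * ENNReal.ofReal (Real.exp (g a))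
  obtain ⟨T, hT⟩ := exists_le_ofReal_exp
    (q := ENNReal.ofReal (Real.exp P) * ENNReal.ofReal c₀ * Q) (by finiteness)
  obtain ⟨B, hB⟩ := hshift g hg0
  obtain ⟨D, hD⟩ := hlow
  refine ExpTight.of_eventually_le fun L hL => ?_
  let r : ℝ := L + T + D
  have hK := isCompact_closure_moment_le (A := A) hgfin (fun i => r + B i)
  refine ⟨_, hK, ?_⟩
  filter_upwards [eventually_ge_atTop 1, hD] with n hn ⟨x, hx, hxD⟩
  rw [weightedDistr_apply _ _ _ _ hK.isClosed.measurableSet.compl]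
  calc _ ≤ ENNReal.ofReal (Real.exp (D * n)) * ∑' x : C n,
        ENNReal.ofReal (Real.exp (birkhoff (shift A) φ n x)) *
        {x : Space A | n * r < ∑ k ∈ Finset.range n, g (x.1 k)}.indicator 1 (x : Space A) := by
        refine mul_le_mul' (inv_Zfn_le _ _ hx hxD) (ENNReal.tsum_le_tsum fun z => ?_)
        refine mul_le_mul' le_rfl (Set.indicator_apply_le fun hz => ?_)
        obtain ⟨i, hi⟩ := exists_lt_sum_of_empirical_notMem hg0 (z : Space A) hn hz
        have h1 := hB n hn z z.2 i
        have h2 : (z : Space A) ∈ {x : Space A | n * r < ∑ k ∈ Finset.range n, g (x.1 k)} := by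
          change n * r < ∑ k ∈ Finset.range n, g (z.1.1 k)
          linarith
        exact (Set.indicator_of_mem h2 _).ge
    _ ≤ ENNReal.ofReal (Real.exp (D * n)) * (ENNReal.ofReal (Real.exp (-(n * r))) *
        ENNReal.ofReal (Real.exp T) ^ n) := by
        gcongr
        refine (h.tsum_exp_birkhoff_indicator_le hc₀ g n r (hinj n hn)).trans ?_
        gcongr
    _ = _ := by
        rw [ofReal_exp_pow, ← ENNReal.ofReal_mul (Real.exp_pos _).le, ← Real.exp_add,
          ← ENNReal.ofReal_mul (Real.exp_pos _).le, ← Real.exp_add]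
        congr 2
        simp only [r]
        ring

end Tightness

section Orbits

variable {S : Type*} {A : S → S → Prop}

/-- In a finitely primitive shift, any two letters are joined by admissible words of every large
length over a fixed finite alphabet. -/
lemma FinitelyPrimitive.exists_path (hA : FinitelyPrimitive A) (a b : S) :
    ∃ (F : Finset S) (n₀ : ℕ), 1 ≤ n₀ ∧ ∀ n ≥ n₀, ∃ w : ℕ → S, w 0 = a ∧ w n = b ∧
      ∀ i < n, A (w i) (w (i + 1)) ∧ w i ∈ F := by
  classical
  obtain ⟨Λ, ⟨N, hN⟩, hΛ⟩ := hA
  let F : Finset S := insert a (Λ.biUnion List.toFinset)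
  have base : ∀ s ∈ F, ∀ t, ∃ w : ℕ → S, w 0 = s ∧ w (N + 1) = t ∧
      ∀ i < N + 1, A (w i) (w (i + 1)) ∧ w i ∈ F := by
    intro s hs t
    obtain ⟨l, hl, -, hchain⟩ := hΛ [s] [t] ⟨List.cons_ne_nil _ _, List.isChain_singleton _⟩
      ⟨List.cons_ne_nil _ _, List.isChain_singleton _⟩
    have hlen := hN l hl
    refine ⟨fun i => (s :: (l ++ [t])).getD i t, by simp, ?_, fun i hi => ⟨?_, ?_⟩⟩
    · simp [← hlen]
    · have := List.isChain_iff_getElem.1 hchain i (by simp; omega)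
      simpa [List.getD_eq_getElem?_getD, List.getElem?_eq_getElem, hlen, hi.le, hi] using this
    · rcases i with _ | i
      · simpa using hs
      · have h1 : i < l.length := by omega
        have h2 : (s :: (l ++ [t])).getD (i + 1) t = l[i] := by
          simp [List.getElem?_append_left h1, h1]
        simp only [h2]
        exact Finset.mem_insert_of_mem
          (Finset.mem_biUnion.2 ⟨l, hl, by simp⟩)
  have step : ∀ s ∈ F, ∃ t ∈ F, A s t := by
    intro s hs
    obtain ⟨w, hw0, hwN, hw⟩ := base s hs a
    refine ⟨w 1, ?_, by simpa [hw0] using (hw 0 (by omega)).1⟩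
    rcases Nat.eq_zero_or_pos N with rfl | hpos
    · rw [hwN]
      exact Finset.mem_insert_self _ _
    · exact (hw 1 (by omega)).2
  have main : ∀ m, ∀ s ∈ F, ∃ w : ℕ → S, w 0 = s ∧ w (N + 1 + m) = b ∧
      ∀ i < N + 1 + m, A (w i) (w (i + 1)) ∧ w i ∈ F := by
    intro m
    induction m with
    | zero => exact fun s hs => base s hs b
    | succ m ih =>
      intro s hs
      obtain ⟨t, ht, hst⟩ := step s hs
      obtain ⟨w, hw0, hwm, hw⟩ := ih t ht
      refine ⟨fun i => Nat.casesOn i s w, rfl, hwm, fun i hi => ?_⟩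
      rcases i with _ | i
      · exact ⟨by simpa [hw0] using hst, hs⟩
      · exact hw i (by omega)
  refine ⟨F, N + 1, by omega, fun n hn => ?_⟩
  obtain ⟨m, rfl⟩ := Nat.exists_eq_add_of_le hn
  exact main m a (Finset.mem_insert_self _ _)

lemma apply_add_of_mem_preimSet {x y : Space A} {n : ℕ} (hx : x ∈ preimSet (shift A) n y) (k : ℕ) :
    x.1 (k + n) = y.1 k := by
  rw [← shift_iterate_apply, show (shift A)^[n] x = y from hx]

lemma periodic_of_mem_perSet {x : Space A} {n : ℕ} (hx : x ∈ perSet (shift A) n) :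
    Function.Periodic x.1 n := fun k => by
  rw [← shift_iterate_apply, show (shift A)^[n] x = x from hx]

lemma eq_of_mem_perSet {x y : Space A} {n : ℕ} (hn : 1 ≤ n) (hx : x ∈ perSet (shift A) n)
    (hy : y ∈ perSet (shift A) n) (hxy : ∀ k < n, x.1 k = y.1 k) : x = y :=
  Subtype.ext <| funext fun k => by
    rw [← (periodic_of_mem_perSet hx).map_mod_nat, ← (periodic_of_mem_perSet hy).map_mod_nat]
    exact hxy _ (Nat.mod_lt _ hn)

lemma eq_of_mem_preimSet {x y z : Space A} {n : ℕ} (hx : x ∈ preimSet (shift A) n z)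
    (hy : y ∈ preimSet (shift A) n z) (hxy : ∀ k < n, x.1 k = y.1 k) : x = y :=
  Subtype.ext <| funext fun k => by
    rcases lt_or_ge k n with hk | hk
    · exact hxy k hk
    · obtain ⟨j, rfl⟩ := Nat.exists_eq_add_of_le' hk
      rw [apply_add_of_mem_preimSet hx, apply_add_of_mem_preimSet hy]

lemma sum_shift_of_mem_perSet (g : S → ℝ) {x : Space A} {n : ℕ} (hx : x ∈ perSet (shift A) n)
    (i : ℕ) :
    ∑ k ∈ Finset.range n, g (x.1 (i + k)) = ∑ k ∈ Finset.range n, g (x.1 k) := by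
  induction i with
  | zero => simp
  | succ i ih =>
    have h1 := Finset.sum_range_succ (fun k => g (x.1 (i + k))) n
    have h2 := Finset.sum_range_succ' (fun k => g (x.1 (i + k))) n
    rw [periodic_of_mem_perSet hx] at h1
    rw [h1, ih] at h2
    simp only [add_zero, add_left_inj] at h2
    rw [h2]
    refine Finset.sum_congr rfl fun k _ => ?_
    rw [add_right_comm, add_assoc]

lemma sum_shift_le_of_mem_preimSet {g : S → ℝ} (hg : ∀ a, 0 ≤ g a) {x y : Space A} {n : ℕ}
    (hn : 1 ≤ n) (hx : x ∈ preimSet (shift A) n y) (i : ℕ) :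
    ∑ k ∈ Finset.range n, g (x.1 (i + k))
      ≤ ∑ k ∈ Finset.range n, g (x.1 k) + n * ∑ j ∈ Finset.range i, g (y.1 j) := by
  have h1 := Finset.sum_range_add (fun k => g (x.1 k)) i n
  have h2 := Finset.sum_range_add (fun k => g (x.1 k)) n i
  have h3 : ∑ j ∈ Finset.range i, g (x.1 (n + j)) = ∑ j ∈ Finset.range i, g (y.1 j) :=
    Finset.sum_congr rfl fun j _ => by rw [add_comm, apply_add_of_mem_preimSet hx]
  have h4 : 0 ≤ ∑ k ∈ Finset.range i, g (x.1 k) := Finset.sum_nonneg fun _ _ => hg _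
  have h5 : 0 ≤ ∑ j ∈ Finset.range i, g (y.1 j) := Finset.sum_nonneg fun _ _ => hg _
  have h6 : (1 : ℝ) ≤ n := by exact_mod_cast hn
  rw [add_comm n i] at h2
  nlinarith [mul_le_mul_of_nonneg_right h6 h5]

lemma exists_mem_perSet {n : ℕ} (hn : 1 ≤ n) {w : ℕ → S} (hw : w n = w 0)
    (hA : ∀ i < n, A (w i) (w (i + 1))) :
    ∃ x ∈ perSet (shift A) n, ∀ i < n, x.1 i = w i := by
  have hx : ∀ i, A (w (i % n)) (w ((i + 1) % n)) := by
    intro i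
    have h1 := hA (i % n) (Nat.mod_lt _ hn)
    rcases Nat.lt_or_ge (i % n + 1) n with h2 | h2
    · have h3 : (i + 1) % n = i % n + 1 := by rw [← Nat.mod_add_mod, Nat.mod_eq_of_lt h2]
      rwa [h3]
    · have h3 : i % n + 1 = n := le_antisymm (Nat.mod_lt _ hn) h2
      have h4 : (i + 1) % n = 0 := by rw [← Nat.mod_add_mod, h3, Nat.mod_self]
      rw [h3, hw] at h1
      rwa [h4]
  let x : Space A := ⟨fun i => w (i % n), hx⟩
  refine ⟨x, Subtype.ext (funext fun i => ?_), fun i hi => ?_⟩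
  · rw [shift_iterate_apply]
    simp [x]
  · simp [x, Nat.mod_eq_of_lt hi]

lemma exists_mem_preimSet {n : ℕ} {y : Space A} {w : ℕ → S} (hw : w n = y.1 0)
    (hA : ∀ i < n, A (w i) (w (i + 1))) :
    ∃ x ∈ preimSet (shift A) n y, ∀ i < n, x.1 i = w i := by
  have hx : ∀ i, A (if i < n then w i else y.1 (i - n))
      (if i + 1 < n then w (i + 1) else y.1 (i + 1 - n)) := by
    intro i
    rcases lt_trichotomy (i + 1) n with h1 | h1 | h1
    · simpa [h1, show i < n by omega] using hA i (by omega)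
    · have h2 := hA i (by omega)
      rw [h1, hw] at h2
      simpa [h1, show i < n by omega] using h2
    · have h2 := y.2 (i - n)
      rw [show i - n + 1 = i + 1 - n by omega] at h2
      simpa [show ¬ i < n by omega, show ¬ i + 1 < n by omega] using h2
  let x : Space A := ⟨fun i => if i < n then w i else y.1 (i - n), hx⟩
  refine ⟨x, Subtype.ext (funext fun i => ?_), fun i hi => ?_⟩
  · rw [shift_iterate_apply]
    simp [x]
  · simp [x, hi]

variable [TopologicalSpace S] {φ : Space A → ℝ} {μ : Measure (Space A)} {c₀ P : ℝ}

lemma IsGibbsWith.exists_mem_perSet_birkhoff (h : IsGibbsWith A φ μ c₀ P) (hc₀ : 1 ≤ c₀)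
    (hA : FinitelyPrimitive A) (a : S) :
    ∃ D : ℝ, ∀ᶠ n : ℕ in atTop, ∃ x ∈ cylinder A [a] ∩ perSet (shift A) n,
      -(D * n) ≤ birkhoff (shift A) φ n x := by
  obtain ⟨F, n₀, h₀, hF⟩ := hA.exists_path a a
  obtain ⟨D, hD⟩ := h.exists_neg_mul_le_birkhoff hc₀ F
  refine ⟨D, eventually_atTop.2 ⟨n₀, fun n hn => ?_⟩⟩
  obtain ⟨w, hw0, hwn, hw⟩ := hF n hn
  obtain ⟨x, hx, hxw⟩ := exists_mem_perSet (h₀.trans hn) (hwn.trans hw0.symm) fun i hi => (hw i hi).1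
  refine ⟨x, ⟨mem_cylinder_singleton.2 ?_, hx⟩, hD n x fun k hk => ?_⟩
  · rw [hxw 0 (by omega), hw0]
  · rw [hxw k hk]
    exact (hw k hk).2

lemma IsGibbsWith.exists_mem_preimSet_birkhoff (h : IsGibbsWith A φ μ c₀ P) (hc₀ : 1 ≤ c₀)
    (hA : FinitelyPrimitive A) (a : S) (y : Space A) :
    ∃ D : ℝ, ∀ᶠ n : ℕ in atTop, ∃ x ∈ cylinder A [a] ∩ preimSet (shift A) n y,
      -(D * n) ≤ birkhoff (shift A) φ n x := by
  obtain ⟨F, n₀, h₀, hF⟩ := hA.exists_path a (y.1 0)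
  obtain ⟨D, hD⟩ := h.exists_neg_mul_le_birkhoff hc₀ F
  refine ⟨D, eventually_atTop.2 ⟨n₀, fun n hn => ?_⟩⟩
  obtain ⟨w, hw0, hwn, hw⟩ := hF n hn
  obtain ⟨x, hx, hxw⟩ := exists_mem_preimSet hwn fun i hi => (hw i hi).1
  refine ⟨x, ⟨mem_cylinder_singleton.2 ?_, hx⟩, hD n x fun k hk => ?_⟩
  · rw [hxw 0 (by omega), hw0]
  · rw [hxw k hk]
    exact (hw k hk).2

end Orbits

end CMS


open CMS in
/-- **Exponential tightness.** For a countable Markov shift with a Gibbs state `μφ`, the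
sequence `ξ_n` of distributions of empirical measures is exponentially tight; if the shift is
finitely primitive, so are `η_n`, `η_{a,n}`, `ζ_{y,n}` and `ζ_{a,y,n}`. -/
theorem exponential_tightness {S : Type*} [Countable S] [TopologicalSpace S] [DiscreteTopology S]
    (A : S → S → Prop) (hA : NoZeroRowCol A)
    (φ : Space A → ℝ) (hφ : Measurable φ)
    (μφ : ProbabilityMeasure (Space A)) (c₀ P : ℝ) (hc₀ : 1 ≤ c₀)
    (hGibbs : IsGibbsWith A φ (μφ : Measure (Space A)) c₀ P) :
    ExpTight (fun n => empDistr (shift A) (μφ : Measure (Space A)) n) ∧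
    (FinitelyPrimitive A → ∀ a : S, ∀ y : Space A,
      ExpTight (fun n => weightedDistr (shift A) φ n (perSet (shift A) n)) ∧
      ExpTight (fun n => weightedDistr (shift A) φ n (cylinder A [a] ∩ perSet (shift A) n)) ∧
      ExpTight (fun n => weightedDistr (shift A) φ n (preimSet (shift A) n y)) ∧
      ExpTight (fun n =>
        weightedDistr (shift A) φ n (cylinder A [a] ∩ preimSet (shift A) n y))) := by
  refine ⟨hGibbs.expTight_empDistr hc₀, fun hprim a y => ?_⟩
  obtain ⟨D, hD⟩ := hGibbs.exists_mem_perSet_birkhoff hc₀ hprim a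
  obtain ⟨D', hD'⟩ := hGibbs.exists_mem_preimSet_birkhoff hc₀ hprim a y
  refine ⟨?_, ?_, ?_, ?_⟩
  · refine hGibbs.expTight_weightedDistr hc₀ (fun n hn x hx z hz => eq_of_mem_perSet hn hx hz)
      (fun g _ => ⟨0, fun n _ x hx i => ?_⟩)
      ⟨D, hD.mono fun n ⟨x, hx, hxD⟩ => ⟨x, hx.2, hxD⟩⟩
    simp [sum_shift_of_mem_perSet g hx]
  · refine hGibbs.expTight_weightedDistr hc₀ (fun n hn x hx z hz => eq_of_mem_perSet hn hx.2 hz.2)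
      (fun g _ => ⟨0, fun n _ x hx i => ?_⟩) ⟨D, hD⟩
    simp [sum_shift_of_mem_perSet g hx.2]
  · exact hGibbs.expTight_weightedDistr hc₀ (fun n _ x hx z hz => eq_of_mem_preimSet hx hz)
      (fun g hg => ⟨_, fun n hn x hx => sum_shift_le_of_mem_preimSet hg hn hx⟩)
      ⟨D', hD'.mono fun n ⟨x, hx, hxD⟩ => ⟨x, hx.2, hxD⟩⟩
  · exact hGibbs.expTight_weightedDistr hc₀ (fun n _ x hx z hz => eq_of_mem_preimSet hx.2 hz.2)
      (fun g hg => ⟨_, fun n hn x hx => sum_shift_le_of_mem_preimSet hg hn hx.2⟩) ⟨D', hD'⟩
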